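/- Let w ∈ S_n be defined by inclusions, let (p,q) ∈ E(w), and set r = r_w(p,q). Then the ideal I_{(p,q,r)} of S equals the ideal generated by the minors d_{{p,…,p+r−1} ∪ {x+r}, {y−r} ∪ {q−r+1,…,q}} for all integers x with p ≤ x ≤ n − r and all integers y with 1 + r ≤ y ≤ q. -/

import Mathlib

/-- One-line notation value of a permutation of `Fin n` at a position `k ∈ {1,…,n}`;
junk value `0` outside that range. -/
def pval {n : ℕ} (w : Equiv.Perm (Fin n)) (k : ℕ) : ℕ :=
  if h : 1 ≤ k ∧ k ≤ n then ((w ⟨k - 1, by omega⟩ : Fin n) : ℕ) + 1 else 0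

/-- The rank function `r_w(p,q) = #{k ≤ q : w(k) ≥ p}`. -/
def rk {n : ℕ} (w : Equiv.Perm (Fin n)) (p q : ℕ) : ℕ :=
  ((Finset.Icc 1 n).filter fun k => k ≤ q ∧ p ≤ pval w k).card

/-- The Rothe diagram `D(w) = {(p,q) ∈ {1,…,n}² : w(q) < p and w⁻¹(p) > q}`. -/
def Diagram {n : ℕ} (w : Equiv.Perm (Fin n)) : Set (ℕ × ℕ) :=
  {pq | 1 ≤ pq.1 ∧ pq.1 ≤ n ∧ 1 ≤ pq.2 ∧ pq.2 ≤ n ∧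
    pval w pq.2 < pq.1 ∧ pq.2 < pval w.symm pq.1}

/-- The essential set `E(w)`. -/
def EssSet {n : ℕ} (w : Equiv.Perm (Fin n)) : Set (ℕ × ℕ) :=
  {pq | pq ∈ Diagram w ∧ (pq.1, pq.2 + 1) ∉ Diagram w ∧ (pq.1 - 1, pq.2) ∉ Diagram w}

/-- Condition A at `(p,q)`: there is no `k` with `k ≤ q` and `w(k) ≥ p`. -/
def CondA {n : ℕ} (w : Equiv.Perm (Fin n)) (p q : ℕ) : Prop :=
  ¬ ∃ k, 1 ≤ k ∧ k ≤ n ∧ k ≤ q ∧ p ≤ pval w k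

/-- Condition B at `(p,q)`: there is no `k` with `k > q` and `w(k) < p`. -/
def CondB {n : ℕ} (w : Equiv.Perm (Fin n)) (p q : ℕ) : Prop :=
  ¬ ∃ k, 1 ≤ k ∧ k ≤ n ∧ q < k ∧ pval w k < p

/-- `w` is defined by inclusions if every essential set box satisfies Condition A or B. -/
def DefinedByInclusions {n : ℕ} (w : Equiv.Perm (Fin n)) : Prop :=
  ∀ p q, (p, q) ∈ EssSet w → CondA w p q ∨ CondB w p q

/-- Index type for the variables `z_{i,j}` with `1 ≤ j < i ≤ n`. -/
abbrev Idx (n : ℕ) : Type := {p : ℕ × ℕ // 1 ≤ p.2 ∧ p.2 < p.1 ∧ p.1 ≤ n}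

/-- The polynomial ring `S = ℚ[z_{i,j} : 1 ≤ j < i ≤ n]`. -/
abbrev PolyS (n : ℕ) : Type := MvPolynomial (Idx n) ℚ

/-- The variable `z_{i,j}` of `S` (junk value `0` when `(i,j)` is out of range). -/
noncomputable def zvar (n : ℕ) (i j : ℕ) : PolyS n :=
  if h : 1 ≤ j ∧ j < i ∧ i ≤ n then MvPolynomial.X ⟨(i, j), h⟩ else 0

/-- The `(i,j)` entry of the matrix `M`: `1` on the diagonal, `z_{i,j}` below the
diagonal, `0` above it (rows and columns indexed by `{1,…,n}`). -/
noncomputable def Mmat (n : ℕ) (i j : ℕ) : PolyS n :=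
  if i = j ∧ 1 ≤ i ∧ i ≤ n then 1 else zvar n i j

/-- The generalized Plücker coordinate `d_{A,B}`: the minor of `M` with rows `A` and
columns `B`, both listed in increasing order (junk value `0` when `#A ≠ #B`). -/
noncomputable def dminor (n : ℕ) (A B : Finset ℕ) : PolyS n :=
  if h : B.card = A.card then
    Matrix.det (Matrix.of fun i j : Fin A.card =>
      Mmat n ((A.orderIsoOfFin rfl i : ℕ)) ((B.orderIsoOfFin h j : ℕ)))
  else 0

/-- The ideal `I_{(p,q,r)}` generated by all `d_{A,B}` with `A ⊆ {p,…,n}`,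
`B ⊆ {1,…,q}` and `#A = #B = r+1`. -/
noncomputable def Iideal (n p q r : ℕ) : Ideal (PolyS n) :=
  Ideal.span {f | ∃ A B : Finset ℕ, A.card = r + 1 ∧ B.card = r + 1 ∧
    A ⊆ Finset.Icc p n ∧ B ⊆ Finset.Icc 1 q ∧ f = dminor n A B}

/-- The ideal `I_w = Σ_{(p,q) ∈ E(w)} I_{(p,q,r_w(p,q))}`. -/
noncomputable def Iw {n : ℕ} (w : Equiv.Perm (Fin n)) : Ideal (PolyS n) :=
  ⨆ pq ∈ EssSet w, Iideal n pq.1 pq.2 (rk w pq.1 pq.2)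

/-- Reindexing rows and columns by two different equivalences changes a determinant by a sign,
so it does not affect its vanishing. -/
theorem Matrix.det_submatrix_equiv_eq_zero_iff {R ι κ : Type*} [CommRing R] [Fintype ι]
    [DecidableEq ι] [Fintype κ] [DecidableEq κ] (N : Matrix κ κ R) (e f : ι ≃ κ) :
    (N.submatrix e f).det = 0 ↔ N.det = 0 := by
  have h : N.submatrix e f = (N.submatrix id (e.symm.trans f)).submatrix e e := by
    ext i j; simp
  rw [h, Matrix.det_submatrix_equiv_self, Matrix.det_permute']
  rcases Int.units_eq_one_or (Equiv.Perm.sign (e.symm.trans f)) with h | h <;> simp [h]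

/-- A square matrix factoring through a smaller dimension has zero determinant. -/
theorem Matrix.det_mul_eq_zero_of_card_lt {R ι κ : Type*} [CommRing R] [Fintype ι]
    [DecidableEq ι] [Fintype κ] (P : Matrix ι κ R) (Q : Matrix κ ι R)
    (h : Fintype.card κ < Fintype.card ι) : (P * Q).det = 0 := by
  classical
  obtain ⟨g⟩ : Nonempty (κ ↪ ι) := Function.Embedding.nonempty_of_card_le h.le
  obtain ⟨i₀, hi₀⟩ : ∃ i, ∀ k, g k ≠ i := by
    by_contra! hc
    exact absurd (Fintype.card_le_of_surjective g hc) (not_le.mpr h)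
  have hinv : ∀ k k', g k = g k' ↔ k = k' := fun k k' => g.injective.eq_iff
  have hfac : P * Q = (P * Matrix.of fun k i => if g k = i then (1 : R) else 0) *
      ((Matrix.of fun i k => if g k = i then (1 : R) else 0) * Q) := by
    rw [Matrix.mul_assoc, ← Matrix.mul_assoc (Matrix.of _) (Matrix.of _) Q]
    congr 1
    convert (Matrix.one_mul Q).symm
    ext k k'
    simp [Matrix.mul_apply, Matrix.one_apply, hinv, eq_comm]
  rw [hfac, Matrix.det_mul]
  convert zero_mul _
  refine Matrix.det_eq_zero_of_column_eq_zero i₀ fun i => ?_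
  simp [Matrix.mul_apply, hi₀]

/-- The vanishing of the image of `d_{A,B}` can be tested on any enumerations of `A` and `B`. -/
theorem map_dminor_eq_zero_iff {n : ℕ} {R ι : Type*} [CommRing R] [Fintype ι] [DecidableEq ι]
    (φ : PolyS n →+* R) {A B : Finset ℕ} (e : ι ≃ A) (f : ι ≃ B) :
    φ (dminor n A B) = 0 ↔ (Matrix.of fun i j => φ (Mmat n (e i) (f j))).det = 0 := by
  have h : B.card = A.card := by
    simpa using Fintype.card_congr (f.symm.trans e)
  rw [dminor, dif_pos h, RingHom.map_det, ← Matrix.det_submatrix_equiv_eq_zero_iff _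
    (e.trans (A.orderIsoOfFin rfl).toEquiv.symm) (f.trans (B.orderIsoOfFin h).toEquiv.symm)]
  congr! 2
  ext i j
  simp [-Finset.coe_orderIsoOfFin_apply]

theorem Mmat_self {n i : ℕ} (h1 : 1 ≤ i) (hn : i ≤ n) : Mmat n i i = 1 := by
  simp [Mmat, h1, hn]

theorem Mmat_eq_zero_of_lt {n i j : ℕ} (h : i < j) : Mmat n i j = 0 := by
  rw [Mmat, if_neg (by omega), zvar, dif_neg (by omega)]

theorem pval_pval_symm {n : ℕ} (w : Equiv.Perm (Fin n)) {k : ℕ} (h1 : 1 ≤ k) (hn : k ≤ n) :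
    pval w (pval w.symm k) = k := by
  simp [pval, h1, hn]

theorem pval_mem_Icc {n : ℕ} (w : Equiv.Perm (Fin n)) {k : ℕ} (h1 : 1 ≤ k) (hn : k ≤ n) :
    pval w k ∈ Finset.Icc 1 n := by
  simp only [pval, h1, hn, and_self, dif_pos, Finset.mem_Icc]
  omega

theorem card_filter_pval_lt {n : ℕ} (w : Equiv.Perm (Fin n)) {p : ℕ} (hp : p ≤ n) :
    ((Finset.Icc 1 n).filter fun k => pval w k < p).card = p - 1 := by
  have h : (Finset.Icc 1 (p - 1)).card = p - 1 := by simp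
  rw [← h]
  refine Finset.card_nbij' (pval w) (pval w.symm) ?_ ?_ ?_ ?_
  · intro k hk
    simp only [Finset.coe_filter, Finset.mem_Icc, Set.mem_ofPred_eq] at hk
    have := pval_mem_Icc w hk.1.1 hk.1.2
    simp only [Finset.mem_Icc, Finset.coe_Icc, Set.mem_Icc] at this ⊢
    omega
  · intro k hk
    simp only [Finset.coe_Icc, Set.mem_Icc] at hk
    have := pval_mem_Icc w.symm hk.1 (by omega : k ≤ n)
    simp only [Finset.coe_filter, Set.mem_ofPred_eq]
    refine ⟨this, ?_⟩
    rw [pval_pval_symm w hk.1 (by omega)]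
    omega
  · intro k hk
    simp only [Finset.coe_filter, Finset.mem_Icc, Set.mem_ofPred_eq] at hk
    exact pval_pval_symm w.symm hk.1.1 hk.1.2
  · intro k hk
    simp only [Finset.coe_Icc, Set.mem_Icc] at hk
    exact pval_pval_symm w hk.1 (by omega)

theorem rk_eq_zero_of_condA {n : ℕ} {w : Equiv.Perm (Fin n)} {p q : ℕ} (h : CondA w p q) :
    rk w p q = 0 := by
  rw [rk, Finset.card_eq_zero, Finset.filter_eq_empty_iff]
  intro k hk hk'
  rw [Finset.mem_Icc] at hk
  exact h ⟨k, hk.1, hk.2, hk'.1, hk'.2⟩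

theorem add_rk_of_condB {n : ℕ} {w : Equiv.Perm (Fin n)} {p q : ℕ} (hp1 : 1 ≤ p) (hp : p ≤ n)
    (hq : q ≤ n) (h : CondB w p q) : p + rk w p q = q + 1 := by
  have hlt : ((Finset.Icc 1 q).filter fun k => ¬ p ≤ pval w k).card = p - 1 := by
    rw [← card_filter_pval_lt w hp]
    congr 1
    ext k
    simp only [Finset.mem_filter, Finset.mem_Icc, not_le]
    constructor
    · rintro ⟨⟨h1, h2⟩, h3⟩
      exact ⟨⟨h1, by omega⟩, h3⟩
    · rintro ⟨⟨h1, h2⟩, h3⟩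
      exact ⟨⟨h1, not_lt.mp fun h4 => h ⟨k, h1, h2, h4, h3⟩⟩, h3⟩
  have hge : rk w p q = ((Finset.Icc 1 q).filter fun k => p ≤ pval w k).card := by
    rw [rk]
    congr 1
    ext k
    simp only [Finset.mem_filter, Finset.mem_Icc]
    constructor
    · rintro ⟨⟨h1, h2⟩, h3, h4⟩
      exact ⟨⟨h1, h3⟩, h4⟩
    · rintro ⟨⟨h1, h2⟩, h3⟩
      exact ⟨⟨h1, by omega⟩, h2, h3⟩
  have := Finset.card_filter_add_card_filter_not (s := Finset.Icc 1 q) fun k => p ≤ pval w k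
  rw [hlt, ← hge, Nat.card_Icc] at this
  omega

/-- The equivalence of `Fin r ⊕ Unit` with `S = {p,…,p+r-1} ∪ {a}`. -/
noncomputable def sumUnitEquiv {p r a : ℕ} {S : Finset ℕ}
    (hS : ∀ k, k ∈ S ↔ (p ≤ k ∧ k < p + r) ∨ k = a) (ha : a < p ∨ p + r ≤ a) :
    Fin r ⊕ Unit ≃ S :=
  Equiv.ofBijective
    (Sum.elim (fun i => ⟨p + i, (hS _).2 (Or.inl ⟨by omega, by omega⟩)⟩)
      fun _ => ⟨a, (hS _).2 (Or.inr rfl)⟩) <| by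
    constructor
    · rintro (i | i) (j | j) h <;> simp [Subtype.ext_iff] at h ⊢ <;> omega
    · rintro ⟨k, hk⟩
      rcases (hS k).1 hk with h | rfl
      · exact ⟨Sum.inl ⟨k - p, by omega⟩, Subtype.ext (by simp; omega)⟩
      · exact ⟨Sum.inr (), rfl⟩

/-- If `U` is an invertible block of a matrix `N` on `r` consecutive rows and columns, and all
minors bordering `U` vanish, then all minors of `N` of size greater than `r` vanish. -/
theorem map_dminor_eq_zero_of_bordered {n p q r : ℕ} {R : Type*} [CommRing R]
    (φ : PolyS n →+* R) (hp : 1 ≤ p) (hq : q ≤ n) (hr : p + r = q + 1)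
    (hφ : ∀ a b, q < a → a ≤ n → 1 ≤ b → b < p →
      φ (dminor n (Finset.Icc p q ∪ {a}) ({b} ∪ Finset.Icc p q)) = 0)
    {A B : Finset ℕ} (hA : A.card = r + 1) (hB : B.card = r + 1)
    (hAs : A ⊆ Finset.Icc p n) (hBs : B ⊆ Finset.Icc 1 q) :
    φ (dminor n A B) = 0 := by
  set U : Matrix (Fin r) (Fin r) R := Matrix.of fun i j => φ (Mmat n (p + i) (p + j)) with hU
  have hdet : U.det = 1 := by
    rw [Matrix.det_of_isLowerTriangular]
    · refine Finset.prod_eq_one fun i _ => ?_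
      rw [hU, Matrix.of_apply, Mmat_self (by omega) (by omega), map_one]
    · intro i j hij
      have hij' : (i : ℕ) < j := hij
      rw [hU, Matrix.of_apply, Mmat_eq_zero_of_lt (by omega), map_zero]
  have hunit : IsUnit U.det := by simp [hdet]
  have hmul : U * U⁻¹ = 1 := Matrix.mul_nonsing_inv _ hunit
  have hmul' : U⁻¹ * U = 1 := Matrix.nonsing_inv_mul _ hunit
  let _ : Invertible U := Matrix.invertibleOfIsUnitDet _ hunit
  let Z (a : ℕ) : Matrix Unit (Fin r) R := Matrix.of fun _ j => φ (Mmat n a (p + j))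
  let X (b : ℕ) : Matrix (Fin r) Unit R := Matrix.of fun i _ => φ (Mmat n (p + i) b)
  have hfac : ∀ a b, p ≤ a → a ≤ n → 1 ≤ b → b ≤ q →
      φ (Mmat n a b) = (Z a * U⁻¹ * X b) () () := by
    intro a b hpa han hb1 hbq
    by_cases ha : a ≤ q
    · obtain ⟨i, rfl⟩ : ∃ i : Fin r, a = p + i := ⟨⟨a - p, by omega⟩, by simp; omega⟩
      have hZ : Z (p + i) = U.submatrix (fun _ => i) id := rfl
      have h1 : Z (p + i) * U⁻¹ * X b = (X b).submatrix (fun _ => i) id := by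
        have : Z (p + i) * U⁻¹ = (1 : Matrix (Fin r) (Fin r) R).submatrix (fun _ => i) id := by
          rw [← hmul]; rfl
        rw [this, ← Matrix.submatrix_id_id (X b),
          ← Matrix.submatrix_mul _ _ _ _ _ Function.bijective_id, Matrix.one_mul]
        rfl
      rw [h1]; rfl
    · by_cases hb : p ≤ b
      · obtain ⟨j, rfl⟩ : ∃ j : Fin r, b = p + j := ⟨⟨b - p, by omega⟩, by simp; omega⟩
        have h1 : Z a * U⁻¹ * X (p + j) = (Z a).submatrix id (fun _ => j) := by
          have : U⁻¹ * X (p + j) =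
              (1 : Matrix (Fin r) (Fin r) R).submatrix id (fun _ => j) := by
            rw [← hmul']; rfl
          rw [Matrix.mul_assoc, this, ← Matrix.submatrix_id_id (Z a),
            ← Matrix.submatrix_mul _ _ _ _ _ Function.bijective_id, Matrix.mul_one]
          rfl
        rw [h1]; rfl
      · have hSA : ∀ k, k ∈ Finset.Icc p q ∪ {a} ↔ (p ≤ k ∧ k < p + r) ∨ k = a := by
          intro k; simp only [Finset.mem_union, Finset.mem_Icc, Finset.mem_singleton]; omega
        have hSB : ∀ k, k ∈ {b} ∪ Finset.Icc p q ↔ (p ≤ k ∧ k < p + r) ∨ k = b := by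
          intro k; simp only [Finset.mem_union, Finset.mem_Icc, Finset.mem_singleton]; omega
        have h0 := (map_dminor_eq_zero_iff φ (sumUnitEquiv hSA (by omega))
          (sumUnitEquiv hSB (by omega))).1 (hφ a b (by omega) han hb1 (by omega))
        have hblk : (Matrix.of fun i j => φ (Mmat n (sumUnitEquiv hSA (by omega) i)
            (sumUnitEquiv hSB (by omega) j))) =
            Matrix.fromBlocks U (X b) (Z a) (Matrix.of fun _ _ => φ (Mmat n a b)) := by
          ext (i | i) (j | j) <;> rfl
        rw [hblk, Matrix.det_fromBlocks₁₁, hdet, one_mul, Matrix.det_unique,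
          Matrix.invOf_eq_nonsing_inv, Matrix.sub_apply, sub_eq_zero] at h0
        exact h0
  rw [map_dminor_eq_zero_iff φ (A.equivFinOfCardEq hA).symm (B.equivFinOfCardEq hB).symm]
  have hprod : (Matrix.of fun i j => φ (Mmat n ((A.equivFinOfCardEq hA).symm i)
      ((B.equivFinOfCardEq hB).symm j))) =
      (Matrix.of fun i k => (Z ((A.equivFinOfCardEq hA).symm i) * U⁻¹) () k) *
      (Matrix.of fun k j => X ((B.equivFinOfCardEq hB).symm j) k ()) := by
    ext i j
    have ha := Finset.mem_Icc.1 (hAs ((A.equivFinOfCardEq hA).symm i).2)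
    have hb := Finset.mem_Icc.1 (hBs ((B.equivFinOfCardEq hB).symm j).2)
    exact hfac _ _ ha.1 ha.2 hb.1 hb.2
  rw [hprod]
  exact Matrix.det_mul_eq_zero_of_card_lt _ _ (by simp)


/-- For `w` defined by inclusions and `(p,q) ∈ E(w)` with `r = r_w(p,q)`, the ideal
`I_{(p,q,r)}` equals the ideal generated by the minors
`d_{{p,…,p+r−1} ∪ {x+r}, {y−r} ∪ {q−r+1,…,q}}` for `p ≤ x ≤ n−r` and `1+r ≤ y ≤ q`. -/
theorem Iideal_eq_span_special_minors {n : ℕ} (w : Equiv.Perm (Fin n))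
    (hw : DefinedByInclusions w) {p q : ℕ} (hpq : (p, q) ∈ EssSet w) :
    Iideal n p q (rk w p q) =
      Ideal.span {f | ∃ x y : ℕ, p ≤ x ∧ x ≤ n - rk w p q ∧
        1 + rk w p q ≤ y ∧ y ≤ q ∧
        f = dminor n (Finset.Icc p (p + rk w p q - 1) ∪ {x + rk w p q})
          ({y - rk w p q} ∪ Finset.Icc (q - rk w p q + 1) q)} := by
  obtain ⟨⟨hp1, hpn, hq1, hqn, -, -⟩, -, -⟩ := id hpq
  have hcases : rk w p q = 0 ∨ p + rk w p q = q + 1 :=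
    (hw p q hpq).imp rk_eq_zero_of_condA (add_rk_of_condB hp1 hpn hqn)
  generalize rk w p q = r at hcases
  apply le_antisymm
  · rw [Iideal, Ideal.span_le]
    rintro _ ⟨A, B, hA, hB, hAs, hBs, rfl⟩
    rcases hcases with rfl | hr
    · obtain ⟨a, rfl⟩ := Finset.card_eq_one.1 hA
      obtain ⟨b, rfl⟩ := Finset.card_eq_one.1 hB
      simp only [Finset.singleton_subset_iff, Finset.mem_Icc] at hAs hBs
      refine Ideal.subset_span ⟨a, b, hAs.1, by omega, by omega, hBs.2, ?_⟩
      rw [Finset.Icc_eq_empty (by omega), Finset.Icc_eq_empty (by omega)]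
      simp
    · rw [SetLike.mem_coe, ← Ideal.Quotient.eq_zero_iff_mem]
      refine map_dminor_eq_zero_of_bordered _ hp1 hqn hr ?_ hA hB hAs hBs
      intro a b hqa han hb1 hbp
      rw [Ideal.Quotient.eq_zero_iff_mem]
      refine Ideal.subset_span ⟨a - r, b + r, by omega, by omega, by omega, by omega, ?_⟩
      rw [show p + r - 1 = q by omega, show a - r + r = a by omega,
        show b + r - r = b by omega, show q - r + 1 = p by omega]
  · rw [Iideal, Ideal.span_le]
    rintro _ ⟨x, y, hpx, hxn, hry, hyq, rfl⟩
    refine Ideal.subset_span ⟨_, _, ?_, ?_, ?_, ?_, rfl⟩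
    · rw [Finset.card_union_of_disjoint (by simp; omega)]
      simp
      omega
    · rw [Finset.card_union_of_disjoint (by simp; omega)]
      simp
      omega
    · intro k hk
      simp only [Finset.mem_union, Finset.mem_Icc, Finset.mem_singleton] at hk ⊢
      omega
    · intro k hk
      simp only [Finset.mem_union, Finset.mem_Icc, Finset.mem_singleton] at hk ⊢
      omega
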